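/- For every k ≥ 1, every x ∈ ℝ² and every d > 2^{−k}, one has μ(B(x,d)) ≥ μ_k(B(x, d − 2^{−k})). -/

import Mathlib

open MeasureTheory Metric Set
open scoped ENNReal

noncomputable section

/-- The point `(a, b)` of the Euclidean plane. -/
def pt (a b : ℝ) : EuclideanSpace ℝ (Fin 2) := (WithLp.equiv 2 (Fin 2 → ℝ)).symm ![a, b]

/-- The translation vectors of the three similitudes. -/
def v : Fin 3 → EuclideanSpace ℝ (Fin 2)
  | 0 => pt 0 0
  | 1 => pt (1/2) 0
  | 2 => pt (1/4) (Real.sqrt 3 / 4)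

/-- The three similitudes generating the Sierpinski gasket. -/
def f (i : Fin 3) (x : EuclideanSpace ℝ (Fin 2)) : EuclideanSpace ℝ (Fin 2) :=
  (1/2 : ℝ) • x + v i

/-- `fword [i₁, …, i_k] = f_{i₁} ∘ ⋯ ∘ f_{i_k}`. -/
def fword : List (Fin 3) → EuclideanSpace ℝ (Fin 2) → EuclideanSpace ℝ (Fin 2)
  | [] => id
  | i :: l => f i ∘ fword l

/-- The similarity dimension `s = log 3 / log 2`. -/
def sDim : ℝ := Real.log 3 / Real.log 2

/-- The normalised Hausdorff measure `μ = H^s(S)⁻¹ • H^s⌊S`. -/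
def muS (S : Set (EuclideanSpace ℝ (Fin 2))) : Measure (EuclideanSpace ℝ (Fin 2)) :=
  (μH[sDim] S)⁻¹ • (μH[sDim]).restrict S

/-- Fixed points `z_i = 2 v_i`. -/
def z (i : Fin 3) : EuclideanSpace ℝ (Fin 2) := (2 : ℝ) • v i

/-- The Hutchinson operator. -/
def Fop (A : Set (EuclideanSpace ℝ (Fin 2))) : Set (EuclideanSpace ℝ (Fin 2)) :=
  f 0 '' A ∪ f 1 '' A ∪ f 2 '' A

/-- The discrete approximations `A_k = F^{k-1}(A₁)`, `A₁ = {z₀, z₁, z₂}`. -/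
def Aset (k : ℕ) : Set (EuclideanSpace ℝ (Fin 2)) := Fop^[k - 1] {z 0, z 1, z 2}

/-- The discrete measures `μ_k`. -/
def muk (k : ℕ) : Measure (EuclideanSpace ℝ (Fin 2)) :=
  ((3 : ℝ≥0∞)⁻¹ ^ k) • ∑ i : Fin (k - 1) → Fin 3,
    (Measure.dirac (fword (List.ofFn i) (z 0)) + Measure.dirac (fword (List.ofFn i) (z 1)) +
      Measure.dirac (fword (List.ofFn i) (z 2)))

/-- The centred Hausdorff premeasure `C₀^s(A)` (the limit as `δ → 0⁺` is written as a
supremum over `δ > 0`, the inner infimum being antitone in `δ`). -/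
def centredPremeasure (s : ℝ) (A : Set (EuclideanSpace ℝ (Fin 2))) : ℝ≥0∞ :=
  ⨆ (δ : ℝ) (_ : 0 < δ),
    ⨅ (x : ℕ → EuclideanSpace ℝ (Fin 2)) (d : ℕ → ℝ) (_ : ∀ n, x n ∈ A)
      (_ : ∀ n, 0 ≤ d n) (_ : ∀ n, 2 * d n ≤ δ) (_ : A ⊆ ⋃ n, closedBall (x n) (d n)),
      ∑' n, ENNReal.ofReal ((2 * d n) ^ s)

/-- The reflection across the vertical line `x₁ = 1/2`. -/
def refl2 (x : EuclideanSpace ℝ (Fin 2)) : EuclideanSpace ℝ (Fin 2) := pt (1 - x 0) (x 1)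

/-- The reflection across the vertical line `x₁ = 1/4`. -/
def refl4 (x : EuclideanSpace ℝ (Fin 2)) : EuclideanSpace ℝ (Fin 2) := pt (1/2 - x 0) (x 1)

lemma sDim_nonneg : 0 ≤ sDim := by unfold sDim; positivity

lemma nnreal_half_rpow_sDim : (2⁻¹ : NNReal) ^ sDim = 3⁻¹ := by
  have h : (2 : ℝ) ^ sDim = 3 := by
    rw [sDim, ← Real.logb, Real.rpow_logb] <;> norm_num
  rw [NNReal.inv_rpow]
  congr 1
  exact NNReal.coe_injective (by simpa using h)

lemma dist_v_le (i j : Fin 3) : dist (v i) (v j) ≤ 1 / 2 := by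
  rw [EuclideanSpace.dist_eq]
  refine Real.sqrt_le_iff.2 ⟨by norm_num, ?_⟩
  have h3 : Real.sqrt 3 ^ 2 = 3 := Real.sq_sqrt (by norm_num)
  fin_cases i <;> fin_cases j <;>
    simp [v, pt, Fin.sum_univ_two, Real.dist_eq, sq_abs] <;> nlinarith

lemma dist_f (i : Fin 3) (a b : EuclideanSpace ℝ (Fin 2)) :
    dist (f i a) (f i b) = 1 / 2 * dist a b := by
  simp only [f, dist_add_right]
  rw [dist_smul₀]
  norm_num

lemma f_z (i : Fin 3) : f i (z i) = z i := by
  simp only [f, z]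
  module

lemma continuous_f (i : Fin 3) : Continuous (f i) := by
  unfold f; fun_prop

lemma preimage_f_closedBall (i : Fin 3) (x : EuclideanSpace ℝ (Fin 2)) (d : ℝ) :
    f i ⁻¹' closedBall x d = closedBall ((2 : ℝ) • (x - v i)) (2 * d) := by
  ext y
  have hx : x = f i ((2 : ℝ) • (x - v i)) := by simp only [f]; module
  rw [mem_preimage, mem_closedBall, mem_closedBall]
  conv_lhs => rw [hx, dist_f]
  constructor <;> intro h <;> linarith

open scoped Pointwise in
lemma hausdorffMeasure_image_f (i : Fin 3) (A : Set (EuclideanSpace ℝ (Fin 2))) :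
    μH[sDim] (f i '' A) = 3⁻¹ * μH[sDim] A := by
  have h : f i '' A = IsometryEquiv.addRight (v i) '' ((1 / 2 : ℝ) • A) := by
    rw [← image_smul, image_image]; rfl
  rw [h, IsometryEquiv.hausdorffMeasure_image,
    Measure.hausdorffMeasure_smul₀ sDim_nonneg (by norm_num)]
  have : ‖(1 / 2 : ℝ)‖₊ = 2⁻¹ := by ext; norm_num
  rw [this, nnreal_half_rpow_sDim, ENNReal.smul_def, smul_eq_mul]
  simp

lemma eq_iUnion_image_f {S : Set (EuclideanSpace ℝ (Fin 2))}
    (hSinv : S = f 0 '' S ∪ f 1 '' S ∪ f 2 '' S) : S = ⋃ i, f i '' S := by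
  conv_lhs => rw [hSinv]
  ext y
  simp only [mem_union, mem_iUnion, Fin.exists_fin_succ, Fin.exists_fin_zero]
  simp [or_assoc]

lemma f_mem {S : Set (EuclideanSpace ℝ (Fin 2))} (hSinv : S = ⋃ i, f i '' S)
    (i : Fin 3) {y : EuclideanSpace ℝ (Fin 2)} (hy : y ∈ S) : f i y ∈ S := by
  rw [hSinv]; exact mem_iUnion.2 ⟨i, mem_image_of_mem _ hy⟩

/-- The gasket lies within distance `1` of each vertex: a farthest point `f i y` from `z j` is at
distance at most `dist y (z j) / 2 + 1 / 2`. -/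
lemma dist_z_le_one {S : Set (EuclideanSpace ℝ (Fin 2))} (hScomp : IsCompact S)
    (hSinv : S = ⋃ i, f i '' S) (j : Fin 3) {y : EuclideanSpace ℝ (Fin 2)} (hy : y ∈ S) :
    dist y (z j) ≤ 1 := by
  obtain ⟨m, hm, hmax⟩ := hScomp.exists_isMaxOn ⟨y, hy⟩
    (f := fun y => dist y (z j)) (by fun_prop)
  have hm' := hm
  rw [hSinv] at hm'
  obtain ⟨i, w, hw, rfl⟩ := mem_iUnion.1 hm'
  have h1 : dist w (z j) ≤ dist (f i w) (z j) := hmax hw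
  have h2 : dist (f i (z j)) (f j (z j)) = dist (v i) (v j) := by simp only [f, dist_add_left]
  have h3 := dist_triangle (f i w) (f i (z j)) (z j)
  rw [f_z] at h2
  have h4 : dist y (z j) ≤ dist (f i w) (z j) := hmax hy
  linarith [dist_f i w (z j), dist_v_le i j]

lemma isProbabilityMeasure_muS {S : Set (EuclideanSpace ℝ (Fin 2))}
    (hSpos : 0 < μH[sDim] S) (hSfin : μH[sDim] S < ⊤) : IsProbabilityMeasure (muS S) := by
  constructor
  simp [muS, ENNReal.inv_mul_cancel hSpos.ne' hSfin.ne]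

lemma muS_le_sum_preimage {S : Set (EuclideanSpace ℝ (Fin 2))} (hSinv : S = ⋃ i, f i '' S)
    {B : Set (EuclideanSpace ℝ (Fin 2))} (hB : MeasurableSet B) :
    muS S B ≤ 3⁻¹ * ∑ i, muS S (f i ⁻¹' B) := by
  have key : μH[sDim] (B ∩ S) ≤ ∑ i, 3⁻¹ * μH[sDim] (f i ⁻¹' B ∩ S) := by
    have hsub : B ∩ S ⊆ ⋃ i, f i '' (f i ⁻¹' B ∩ S) := by
      rintro y ⟨hyB, hyS⟩
      rw [hSinv] at hyS
      obtain ⟨i, w, hw, rfl⟩ := mem_iUnion.1 hyS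
      exact mem_iUnion.2 ⟨i, w, ⟨hyB, hw⟩, rfl⟩
    calc μH[sDim] (B ∩ S) ≤ μH[sDim] (⋃ i, f i '' (f i ⁻¹' B ∩ S)) := measure_mono hsub
      _ ≤ ∑ i, μH[sDim] (f i '' (f i ⁻¹' B ∩ S)) := measure_iUnion_fintype_le _ _
      _ = _ := by simp only [hausdorffMeasure_image_f]
  have hmeas i : MeasurableSet (f i ⁻¹' B) := (continuous_f i).measurable hB
  simp only [muS, Measure.smul_apply, smul_eq_mul, Measure.restrict_apply hB,
    Measure.restrict_apply (hmeas _)]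
  rw [← Finset.mul_sum, mul_left_comm]
  rw [← Finset.mul_sum] at key
  gcongr

/-- Both sides of `muS_le_sum_preimage` have total mass one, so it can be reversed by passing to
complements. -/
lemma sum_preimage_le_muS {S : Set (EuclideanSpace ℝ (Fin 2))} (hSinv : S = ⋃ i, f i '' S)
    (hSpos : 0 < μH[sDim] S) (hSfin : μH[sDim] S < ⊤)
    {B : Set (EuclideanSpace ℝ (Fin 2))} (hB : MeasurableSet B) :
    3⁻¹ * ∑ i, muS S (f i ⁻¹' B) ≤ muS S B := by
  have := isProbabilityMeasure_muS hSpos hSfin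
  have hmeas i : MeasurableSet (f i ⁻¹' B) := (continuous_f i).measurable hB
  have h := muS_le_sum_preimage hSinv hB.compl
  have h3 : (3⁻¹ : ℝ≥0∞) * 3 = 1 := ENNReal.inv_mul_cancel (by norm_num) (by norm_num)
  have hsum : 3⁻¹ * ∑ i, muS S (f i ⁻¹' B) + 3⁻¹ * ∑ i, muS S (f i ⁻¹' Bᶜ) = 1 := by
    rw [← mul_add, ← Finset.sum_add_distrib]
    simp_rw [preimage_compl, prob_add_prob_compl (hmeas _)]
    simpa using h3
  have hfin : muS S Bᶜ ≠ ⊤ := measure_ne_top _ _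
  refine (ENNReal.add_le_add_iff_right hfin).1 ?_
  rw [prob_add_prob_compl hB, ← hsum]
  gcongr

lemma muk_one_apply {B : Set (EuclideanSpace ℝ (Fin 2))} :
    muk 1 B = 3⁻¹ * ∑ j, Measure.dirac (z j) B := by
  simp [muk, fword, Fin.sum_univ_three, mul_add]

lemma muk_succ_apply (n : ℕ) {B : Set (EuclideanSpace ℝ (Fin 2))} (hB : MeasurableSet B) :
    muk (n + 2) B = 3⁻¹ * ∑ j, muk (n + 1) (f j ⁻¹' B) := by
  have hmeas i : MeasurableSet (f i ⁻¹' B) := (continuous_f i).measurable hB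
  simp only [muk, Nat.add_succ_sub_one, Measure.smul_apply, Measure.finsetSum_apply,
    Measure.add_apply, smul_eq_mul, Measure.dirac_apply' _ hB, Measure.dirac_apply' _ (hmeas _)]
  rw [← Finset.mul_sum, ← mul_assoc, ← pow_succ', ← Fintype.sum_prod_type',
    ← (Fin.consEquiv fun _ : Fin (n + 1) => Fin 3).sum_comp]
  congr 1
  refine Finset.sum_congr rfl fun p _ => ?_
  have h : List.ofFn (Fin.consEquiv (fun _ : Fin (n + 1) => Fin 3) p) = p.1 :: List.ofFn p.2 :=
    List.ofFn_cons p.1 p.2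
  rw [h]
  rfl

lemma muk_one_closedBall_le {S : Set (EuclideanSpace ℝ (Fin 2))} (hScomp : IsCompact S)
    (hSinv : S = ⋃ i, f i '' S) (hSpos : 0 < μH[sDim] S) (hSfin : μH[sDim] S < ⊤)
    (x : EuclideanSpace ℝ (Fin 2)) (d : ℝ) :
    muk 1 (closedBall x (d - 1 / 2)) ≤ muS S (closedBall x d) := by
  refine le_trans ?_ (sum_preimage_le_muS hSinv hSpos hSfin measurableSet_closedBall)
  rw [muk_one_apply]
  refine mul_le_mul_right (Finset.sum_le_sum fun j _ => ?_) _
  rw [Measure.dirac_apply' _ measurableSet_closedBall]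
  by_cases hj : z j ∈ closedBall x (d - 1 / 2)
  swap
  · rw [indicator_of_notMem hj]
    exact zero_le
  rw [indicator_of_mem hj, Pi.one_apply]
  have hsub : S ⊆ f j ⁻¹' closedBall x d := fun y hy => by
    have h1 := dist_z_le_one hScomp hSinv j hy
    have h2 := dist_f j y (z j)
    rw [f_z] at h2
    have h3 := dist_triangle (f j y) (z j) x
    rw [mem_closedBall] at hj
    rw [mem_preimage, mem_closedBall]
    linarith
  calc (1 : ℝ≥0∞) = muS S S := by
        simp [muS, ENNReal.inv_mul_cancel hSpos.ne' hSfin.ne]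
    _ ≤ _ := measure_mono hsub

theorem statement13 (S : Set (EuclideanSpace ℝ (Fin 2))) (hScomp : IsCompact S) (hSne : S.Nonempty)
    (hSinv : S = f 0 '' S ∪ f 1 '' S ∪ f 2 '' S)
    (hSpos : 0 < μH[sDim] S) (hSfin : μH[sDim] S < ⊤)
    (k : ℕ) (hk : 1 ≤ k) (x : EuclideanSpace ℝ (Fin 2)) (d : ℝ)
    (hd : (2 : ℝ) ^ (-(k : ℤ)) < d) :
    muk k (closedBall x (d - (2 : ℝ) ^ (-(k : ℤ)))) ≤ muS S (closedBall x d) := by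
  have hSinv' := eq_iUnion_image_f hSinv
  clear hd
  obtain ⟨n, rfl⟩ := Nat.exists_eq_add_of_le' hk
  induction n generalizing x d with
  | zero => simpa using muk_one_closedBall_le hScomp hSinv' hSpos hSfin x d
  | succ n ih =>
    refine le_trans ?_ (sum_preimage_le_muS hSinv' hSpos hSfin measurableSet_closedBall)
    rw [muk_succ_apply n measurableSet_closedBall]
    simp only [preimage_f_closedBall]
    refine mul_le_mul_right (Finset.sum_le_sum fun j _ => ?_) _
    have hpow : 2 * (d - (2 : ℝ) ^ (-((n + 1 + 1 : ℕ) : ℤ)))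
        = 2 * d - (2 : ℝ) ^ (-((n + 1 : ℕ) : ℤ)) := by
      simp only [zpow_neg, zpow_natCast, pow_succ]
      field_simp
    rw [hpow]
    exact ih _ _ (by omega)

end
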